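/- arXiv:1509.08484 — 2 statements merged into one kernel-verified Lean document; each statement's English description precedes it below -/
import Mathlib

section
/- Let f: M → M be a definable function. All but finitely many p ∈ M have an open neighborhood V on which one of the following holds: (1) the restriction of f to V is constant; or (2) f(V) is open and the restriction of f to V is a homeomorphism onto its image. -/
/-! Common framework: dp-minimal structures with a definable uniform structure,
following "Dp-minimal structures equipped with definable uniformities". -/

namespace DpTame

open FirstOrder Set Cardinal

universe u

variable (L : FirstOrder.Language.{u, u}) (M : Type u) [L.Structure M]

/-- `A ⊆ M^α` is definable with parameters from `C ⊆ M`. -/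
def DefSetP (C : Set M) {α : Type} (A : Set (α → M)) : Prop :=
  C.Definable L A

/-- `A ⊆ M^α` is definable (with parameters from `M`). -/
def DefSet {α : Type} (A : Set (α → M)) : Prop :=
  (Set.univ : Set M).Definable L A

/-- A subset of `M` is definable (with parameters). -/
def DefSet1 (A : Set M) : Prop :=
  DefSet L M {v : Fin 1 → M | v 0 ∈ A}

/-- A definable relation between two tuple sorts, with parameters from `C`. -/
def DefRelP (C : Set M) {k l : ℕ} (G : Set ((Fin k → M) × (Fin l → M))) : Prop :=
  DefSetP L M C {v : (Fin k ⊕ Fin l) → M | (v ∘ Sum.inl, v ∘ Sum.inr) ∈ G}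

/-- A definable relation between two tuple sorts, with parameters from `M`. -/
def DefRel {k l : ℕ} (G : Set ((Fin k → M) × (Fin l → M))) : Prop :=
  DefRelP L M Set.univ G

/-- A definable subset of `M × M`. -/
def DefRel1 (G : Set (M × M)) : Prop :=
  DefSet L M {v : Fin 2 → M | (v 0, v 1) ∈ G}

/-- Model-theoretic algebraic closure of a parameter set `C ⊆ M`:
`a` lies in a finite `C`-definable set. -/
def aclOf (C : Set M) : Set M :=
  {a | ∃ S : Set (Fin 1 → M), C.Definable L S ∧ S.Finite ∧ (fun _ => a) ∈ S}

/-- The acl-dimension of a tuple over `C`: the minimal size of a subtuple over which (together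
with `C`) the whole tuple is algebraic. -/
noncomputable def aclDimTuple (C : Set M) {k : ℕ} (a : Fin k → M) : ℕ :=
  sInf {l | ∃ s : Finset (Fin k), s.card = l ∧ ∀ i, a i ∈ aclOf L M (C ∪ (a '' ↑s))}

open Classical in
/-- The acl-dimension of a set `A ⊆ M^k` defined over `C` (with `⊥` for the empty set). -/
noncomputable def aclDim (C : Set M) {k : ℕ} (A : Set (Fin k → M)) : WithBot ℕ :=
  if A = ∅ then ⊥ else ↑(sSup {l | ∃ a ∈ A, aclDimTuple L M C a = l})

/-- `A ⊆ M^k` has dp-rank greater than `n`: there are (definable-with-parameters) formulas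
`φ_i(x,y)` for `i ≤ n` (coded as definable subsets of `M^k × M`) and infinite sets `B i ⊆ M`
such that every choice from `∏ B i` is coded by an element of `A`. -/
def DpRankGt {k : ℕ} (A : Set (Fin k → M)) (n : ℕ) : Prop :=
  ∃ (Φ : Fin (n + 1) → Set ((Fin k ⊕ Fin 1) → M)) (B : Fin (n + 1) → Set M),
    (∀ i, DefSet L M (Φ i)) ∧ (∀ i, (B i).Infinite) ∧
    ∀ b : Fin (n + 1) → M, (∀ i, b i ∈ B i) →
      ∃ a ∈ A, ∀ i, ∀ y ∈ B i, (Sum.elim a (fun _ => y) ∈ Φ i ↔ y = b i)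

open Classical in
/-- The dp-rank of a definable set, with `⊥` for the empty set. -/
noncomputable def dpRank {k : ℕ} (A : Set (Fin k → M)) : WithBot ℕ :=
  if A = ∅ then ⊥ else ↑(sSup {m : ℕ | ∃ n, m = n + 1 ∧ DpRankGt L M A n})

/-- Dp-minimality (with respect to the home sort `M`): `M` does not have dp-rank greater
than one. -/
def DpMinimal : Prop :=
  ¬ DpRankGt L M (Set.univ : Set (Fin 1 → M)) 1

/-- `M` is NIP: no definable relation has the independence property. -/
def IsNIP : Prop :=
  ∀ (n m : ℕ) (Φ : Set ((Fin n ⊕ Fin m) → M)), DefSet L M Φ →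
    ¬ ∃ (a : ℕ → Fin n → M) (b : Finset ℕ → Fin m → M),
        ∀ (i : ℕ) (s : Finset ℕ), (Sum.elim (a i) (b s) ∈ Φ ↔ i ∈ s)

/-- Every finitely satisfiable collection of formulas in one variable over `C` is realized. -/
def RealizesTypesOver (C : Set M) : Prop :=
  ∀ p : Set ((L[[C]]).Formula (Fin 1)),
    (∀ s : Finset ((L[[C]]).Formula (Fin 1)), ↑s ⊆ p →
      ∃ a : M, ∀ φ ∈ s, φ.Realize (fun _ => a)) →
    ∃ a : M, ∀ φ ∈ p, φ.Realize (fun _ => a)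

/-- `M` is `|L|⁺`-saturated. -/
def IsLPlusSaturated : Prop :=
  ∀ C : Set M, #C ≤ L.card + ℵ₀ → RealizesTypesOver L M C

/-- Two tuples have the same type over `C`. -/
def SameTypeOver (C : Set M) {n : ℕ} (a b : Fin n → M) : Prop :=
  ∀ φ : (L[[C]]).Formula (Fin n), φ.Realize a ↔ φ.Realize b

/-- A sequence indexed by `ℕ` is indiscernible over `C`. -/
def IndiscernibleOver (C : Set M) (I : ℕ → M) : Prop :=
  ∀ (n : ℕ) (f g : Fin n → ℕ), StrictMono f → StrictMono g →
    SameTypeOver L M C (I ∘ f) (I ∘ g)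

/-- The sequences `I l` are mutually indiscernible over `C`: each is indiscernible over `C`
together with all of the other sequences. -/
def MutuallyIndiscernibleOver (C : Set M) {k : ℕ} (I : Fin k → ℕ → M) : Prop :=
  ∀ l : Fin k,
    IndiscernibleOver L M (C ∪ ⋃ m ∈ ({m : Fin k | m ≠ l} : Set (Fin k)), Set.range (I m)) (I l)

/-- A correspondence with domain `E ⊆ M^k`, values in `M^l`, definable over `C`: a definable
graph all of whose fibers over points of `E` are finite and nonempty. -/
def IsCorrP (C : Set M) {k l : ℕ} (E : Set (Fin k → M))
    (G : Set ((Fin k → M) × (Fin l → M))) : Prop :=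
  DefRelP L M C G ∧ (∀ p ∈ G, p.1 ∈ E) ∧
    ∀ x ∈ E, {y | (x, y) ∈ G}.Nonempty ∧ {y | (x, y) ∈ G}.Finite

/-- A correspondence, definable with arbitrary parameters. -/
def IsCorr {k l : ℕ} (E : Set (Fin k → M)) (G : Set ((Fin k → M) × (Fin l → M))) : Prop :=
  IsCorrP L M Set.univ E G

/-- An `m`-correspondence: every fiber has exactly `m` elements. -/
def IsMCorrP (C : Set M) {k l : ℕ} (E : Set (Fin k → M))
    (G : Set ((Fin k → M) × (Fin l → M))) (m : ℕ) : Prop :=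
  IsCorrP L M C E G ∧ ∀ x ∈ E, {y | (x, y) ∈ G}.ncard = m

/-- An `m`-correspondence definable with arbitrary parameters. -/
def IsMCorr {k l : ℕ} (E : Set (Fin k → M)) (G : Set ((Fin k → M) × (Fin l → M)))
    (m : ℕ) : Prop :=
  IsMCorrP L M Set.univ E G m

/-- A definable uniform structure on `M`: a definable basis of entourages
`{φ(M², c̄) : c̄ ∈ dom}` satisfying the axioms for a basis of a (Hausdorff) uniformity. -/
structure DefUniformBasis where
  n : ℕ
  dom : Set (Fin n → M)
  dom_nonempty : dom.Nonempty
  dom_def : DefSet L M dom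
  phi : Set ((Fin 2 ⊕ Fin n) → M)
  phi_def : DefSet L M phi
  symm : ∀ c ∈ dom, ∀ x y : M, Sum.elim ![x, y] c ∈ phi → Sum.elim ![y, x] c ∈ phi
  inter_eq_diag : ∀ x y : M, (∀ c ∈ dom, Sum.elim ![x, y] c ∈ phi) ↔ x = y
  directed : ∀ c ∈ dom, ∀ d ∈ dom, ∃ e ∈ dom, ∀ x y : M,
    Sum.elim ![x, y] e ∈ phi → Sum.elim ![x, y] c ∈ phi ∧ Sum.elim ![x, y] d ∈ phi
  comp : ∀ c ∈ dom, ∃ d ∈ dom, ∀ x y z : M,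
    Sum.elim ![x, y] d ∈ phi → Sum.elim ![y, z] d ∈ phi → Sum.elim ![x, z] c ∈ phi

namespace DefUniformBasis

variable {L M} (U : DefUniformBasis L M)

/-- The entourage with parameter `c`. -/
def ent (c : Fin U.n → M) : Set (M × M) :=
  {p | Sum.elim ![p.1, p.2] c ∈ U.phi}

/-- The ball of radius `c` around `x ∈ M`. -/
def ball (c : Fin U.n → M) (x : M) : Set M :=
  {y | (x, y) ∈ U.ent c}

/-- The ball of radius `c` around `x ∈ M^k` (product uniformity). -/
def ballk {k : ℕ} (c : Fin U.n → M) (x : Fin k → M) : Set (Fin k → M) :=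
  {y | ∀ i, (x i, y i) ∈ U.ent c}

/-- Openness in `M` for the topology induced by the uniform structure. -/
def IsOpen1 (A : Set M) : Prop :=
  ∀ x ∈ A, ∃ c ∈ U.dom, U.ball c x ⊆ A

/-- Interior in `M`. -/
def interior1 (A : Set M) : Set M :=
  {x | ∃ c ∈ U.dom, U.ball c x ⊆ A}

/-- Closure in `M`. -/
def closure1 (A : Set M) : Set M :=
  {x | ∀ c ∈ U.dom, (U.ball c x ∩ A).Nonempty}

/-- Openness in `M^k` for the product topology. -/
def IsOpenk {k : ℕ} (A : Set (Fin k → M)) : Prop :=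
  ∀ x ∈ A, ∃ c ∈ U.dom, U.ballk c x ⊆ A

/-- Interior in `M^k`. -/
def interiork {k : ℕ} (A : Set (Fin k → M)) : Set (Fin k → M) :=
  {x | ∃ c ∈ U.dom, U.ballk c x ⊆ A}

/-- Closure in `M^k`. -/
def closurek {k : ℕ} (A : Set (Fin k → M)) : Set (Fin k → M) :=
  {x | ∀ c ∈ U.dom, (U.ballk c x ∩ A).Nonempty}

/-- The frontier `∂A = cl(A) ∖ A`. -/
def frontierk {k : ℕ} (A : Set (Fin k → M)) : Set (Fin k → M) :=
  U.closurek A \ A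

/-- Closedness in `M^k`. -/
def IsClosedk {k : ℕ} (A : Set (Fin k → M)) : Prop :=
  U.closurek A ⊆ A

/-- `B` is dense in `A`. -/
def DenseIn {k : ℕ} (B A : Set (Fin k → M)) : Prop :=
  A ⊆ U.closurek B

/-- `A ⊆ M^k` is locally closed: every point of `A` has a (ball) neighborhood `W` such that
`A ∩ W` is closed in `W`. -/
def IsLocallyClosedk {k : ℕ} (A : Set (Fin k → M)) : Prop :=
  ∀ x ∈ A, ∃ c ∈ U.dom, U.ballk c x ∩ U.closurek (A ∩ U.ballk c x) ⊆ A

open Classical in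
/-- The naive topological dimension of `A ⊆ M^k`: the largest `l` such that some coordinate
projection of `A` to `M^l` has nonempty interior (`⊥` for the empty set). -/
noncomputable def topDim {k : ℕ} (A : Set (Fin k → M)) : WithBot ℕ :=
  if A = ∅ then ⊥ else
    ↑(sSup {l : ℕ | ∃ σ : Fin l → Fin k, Function.Injective σ ∧
        (U.interiork ((fun v => v ∘ σ) '' A)).Nonempty})

/-- Continuity of a correspondence with domain `E` and graph `G` at a point `x ∈ E`. -/
def CorrContAt {k l : ℕ} (E : Set (Fin k → M)) (G : Set ((Fin k → M) × (Fin l → M)))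
    (x : Fin k → M) : Prop :=
  ∀ c ∈ U.dom, ∃ d ∈ U.dom, ∀ x' ∈ E, x' ∈ U.ballk d x →
    (∀ y, (x, y) ∈ G → ∃ y', (x', y') ∈ G ∧ ∀ j, (y j, y' j) ∈ U.ent c) ∧
    (∀ y', (x', y') ∈ G → ∃ y, (x, y) ∈ G ∧ ∀ j, (y j, y' j) ∈ U.ent c)

/-- Continuity of a correspondence at every point of its domain. -/
def CorrContOn {k l : ℕ} (E : Set (Fin k → M)) (G : Set ((Fin k → M) × (Fin l → M))) : Prop :=
  ∀ x ∈ E, U.CorrContAt E G x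

/-- Continuity of a function `M^k → M^l` on a set `V` (relative topology). -/
def ContOn {k l : ℕ} (f : (Fin k → M) → (Fin l → M)) (V : Set (Fin k → M)) : Prop :=
  ∀ x ∈ V, ∀ c ∈ U.dom, ∃ d ∈ U.dom, ∀ y ∈ V, y ∈ U.ballk d x → f y ∈ U.ballk c (f x)

/-- `f` restricted to `V` is a homeomorphism onto its image. -/
def HomeoOnto {k l : ℕ} (f : (Fin k → M) → (Fin l → M)) (V : Set (Fin k → M)) : Prop :=
  Set.InjOn f V ∧ U.ContOn f V ∧
    ∀ x ∈ V, ∀ c ∈ U.dom, ∃ d ∈ U.dom, ∀ y ∈ V, f y ∈ U.ballk d (f x) → y ∈ U.ballk c x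

/-- Continuity of a function `M → M` on a set `V`. -/
def Cont1On (f : M → M) (V : Set M) : Prop :=
  ∀ x ∈ V, ∀ c ∈ U.dom, ∃ d ∈ U.dom, ∀ y ∈ V, y ∈ U.ball d x → f y ∈ U.ball c (f x)

/-- `f : M → M` restricted to `V` is a homeomorphism onto its image. -/
def Homeo1Onto (f : M → M) (V : Set M) : Prop :=
  Set.InjOn f V ∧ U.Cont1On f V ∧
    ∀ x ∈ V, ∀ c ∈ U.dom, ∃ d ∈ U.dom, ∀ y ∈ V, f y ∈ U.ball d (f x) → y ∈ U.ball c x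

end DefUniformBasis

/-- The standing assumptions of the paper: `M` is an infinite `|L|⁺`-saturated NIP dp-minimal
structure carrying a definable uniform structure whose topology has no isolated points and in
which every infinite definable subset of `M` has nonempty interior (Inf). -/
structure Setting extends DefUniformBasis L M where
  nonempty : Nonempty M
  saturated : IsLPlusSaturated L M
  nip : IsNIP L M
  dpMin : DpMinimal L M
  noIsolated : ∀ x : M, ∀ c ∈ toDefUniformBasis.dom, ∃ y, y ≠ x ∧
    y ∈ toDefUniformBasis.ball c x
  infInterior : ∀ A : Set M, DefSet1 L M A → A.Infinite →
    (toDefUniformBasis.interior1 A).Nonempty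

end DpTame

namespace DpTame

open FirstOrder Set Cardinal

universe u

variable {L : FirstOrder.Language.{u, u}} {M : Type u} [L.Structure M]

/-! ### Definable predicates -/

variable (L) in
/-- A predicate on tuples indexed by `α` is definable with parameters. -/
def DefPred {α : Type} (P : (α → M) → Prop) : Prop :=
  DefSet L M {v | P v}

variable (L) in
/-- A function on tuples indexed by `α` is definable, i.e. has definable graph. -/
def DefFun {α : Type} (t : (α → M) → M) : Prop :=
  DefPred L fun v : α ⊕ Fin 1 → M => t (fun a => v (Sum.inl a)) = v (Sum.inr 0)

section DefPred

variable {α β : Type} {P Q : (α → M) → Prop}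

theorem DefPred.congr (hP : DefPred L P) (h : ∀ v, Q v ↔ P v) : DefPred L Q := by
  have : Q = P := funext fun v => propext (h v)
  rwa [this]

theorem DefPred.not (hP : DefPred L P) : DefPred L fun v => ¬ P v :=
  Set.Definable.compl hP

theorem DefPred.and (hP : DefPred L P) (hQ : DefPred L Q) : DefPred L fun v => P v ∧ Q v :=
  Set.Definable.inter hP hQ

theorem DefPred.imp (hP : DefPred L P) (hQ : DefPred L Q) : DefPred L fun v => P v → Q v :=
  (hP.and hQ.not).not.congr fun v => by tauto

theorem DefPred.const (p : Prop) : DefPred L fun _ : α → M => p := by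
  by_cases hp : p
  · exact DefPred.congr (P := fun _ => True) Set.definable_univ fun v => by simp [hp]
  · exact DefPred.congr (P := fun _ => False) Set.definable_empty fun v => by simp [hp]

theorem DefPred.forall_finite {ι : Type} [Finite ι] {R : ι → (α → M) → Prop}
    (h : ∀ i, DefPred L (R i)) : DefPred L fun v => ∀ i, R i v :=
  DefPred.congr (P := fun v => v ∈ ⋂ i, {v | R i v})
    (Set.definable_iInter_of_finite h) fun v => by simp

theorem DefPred.comp (hP : DefPred L P) (g : α → β) : DefPred L fun v : β → M => P (v ∘ g) :=
  Set.Definable.preimage_comp g hP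

theorem DefPred.exists_tuple [Finite β] {R : (α → M) → (β → M) → Prop}
    (h : DefPred L fun v : α ⊕ β → M => R (fun a => v (Sum.inl a)) (fun b => v (Sum.inr b))) :
    DefPred L fun v => ∃ w, R v w :=
  Set.Definable.exists_of_finite h

theorem DefPred.forall_tuple [Finite β] {R : (α → M) → (β → M) → Prop}
    (h : DefPred L fun v : α ⊕ β → M => R (fun a => v (Sum.inl a)) (fun b => v (Sum.inr b))) :
    DefPred L fun v => ∀ w, R v w :=
  Set.Definable.forall_of_finite h

theorem DefPred.exists {R : (α → M) → M → Prop}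
    (h : DefPred L fun v : α ⊕ Fin 1 → M => R (fun a => v (Sum.inl a)) (v (Sum.inr 0))) :
    DefPred L fun v => ∃ x, R v x :=
  (DefPred.exists_tuple (R := fun v (w : Fin 1 → M) => R v (w 0)) h).congr fun _ =>
    ⟨fun ⟨x, hx⟩ => ⟨fun _ => x, hx⟩, fun ⟨w, hw⟩ => ⟨w 0, hw⟩⟩

theorem DefPred.forall {R : (α → M) → M → Prop}
    (h : DefPred L fun v : α ⊕ Fin 1 → M => R (fun a => v (Sum.inl a)) (v (Sum.inr 0))) :
    DefPred L fun v => ∀ x, R v x :=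
  (DefPred.forall_tuple (R := fun v (w : Fin 1 → M) => R v (w 0)) h).congr fun _ =>
    ⟨fun H w => H (w 0), fun H x => H fun _ => x⟩

theorem DefFun.proj (a : α) : DefFun L fun v : α → M => v a := by
  have h := Set.Definable.preimage_comp (fun i : Fin 2 => ![Sum.inl a, Sum.inr (0 : Fin 1)] i)
    ((Set.Definable.diagonal L (Set.univ : Set M)))
  exact h

theorem DefFun.const (m : M) : DefFun L fun _ : α → M => m := by
  have h := Set.Definable.preimage_comp (fun _ : Fin 1 => (Sum.inr (0 : Fin 1) : α ⊕ Fin 1))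
    (Set.Definable.singleton_of_mem (L := L) (Set.mem_univ m))
  exact DefPred.congr h fun v => eq_comm

/-- Definable predicates are closed under substitution of definable functions. -/
theorem DefPred.subst [Finite β] {R : (β → M) → Prop} (hR : DefPred L R)
    {t : β → (α → M) → M} (ht : ∀ b, DefFun L (t b)) : DefPred L fun v => R fun b => t b v := by
  refine DefPred.congr
    (P := fun v => ∃ w : β → M, (∀ b, t b v = w b) ∧ R w) ?_ ?_
  · refine DefPred.exists_tuple (.and (.forall_finite fun b => ?_) ?_)
    · exact (DefPred.comp (ht b) (Sum.map id fun _ => b) :)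
    · exact hR.comp Sum.inr
  · intro v
    exact ⟨fun h => ⟨_, fun _ => rfl, h⟩, fun ⟨w, hw, h⟩ => by
      have : (fun b => t b v) = w := funext hw
      rwa [this]⟩

theorem DefPred.eq {s t : (α → M) → M} (hs : DefFun L s) (ht : DefFun L t) :
    DefPred L fun v => s v = t v := by
  have h : DefPred L fun v : Fin 2 → M => v 0 = v 1 := Set.Definable.diagonal L (Set.univ : Set M)
  exact h.subst (t := ![s, t]) (by simp [Fin.forall_fin_two, hs, ht])

theorem DefFun.comp_graph {f : M → M} (hf : DefPred L fun v : Fin 2 → M => f (v 0) = v 1)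
    {t : (α → M) → M} (ht : DefFun L t) : DefFun L fun v => f (t v) := by
  have h : DefPred L fun v : α ⊕ Fin 1 → M =>
      ∃ x, t (fun a => v (Sum.inl a)) = x ∧ f x = v (Sum.inr 0) := by
    refine .exists (.and ?_ ?_)
    · exact (DefPred.comp ht (Sum.map Sum.inl id) :)
    · exact (hf.comp (![Sum.inr 0, Sum.inl (Sum.inr 0)] : Fin 2 → (α ⊕ Fin 1) ⊕ Fin 1) :)
  exact h.congr fun v => by simp

theorem DefPred.mem_set1 {A : Set M} (hA : DefSet1 L M A) {t : (α → M) → M} (ht : DefFun L t) :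
    DefPred L fun v => t v ∈ A :=
  DefPred.subst (R := fun v : Fin 1 → M => v 0 ∈ A) hA (t := fun _ => t) fun _ => ht

theorem defSet1_image {f : M → M}
    (hf : DefPred L fun v : Fin 2 → M => f (v 0) = v 1) {A : Set M} (hA : DefSet1 L M A) :
    DefSet1 L M (f '' A) :=
  DefPred.exists (R := fun v x => x ∈ A ∧ f x = v 0)
    (.and (.mem_set1 hA (.proj _)) (.eq (.comp_graph hf (.proj _)) (.proj _)))

end DefPred

/-! ### Saturation -/

/-- In an `|L|⁺`-saturated structure, a decreasing sequence of nonempty definable subsets of `M`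
has a common point. -/
theorem IsLPlusSaturated.exists_forall_mem_one (hsat : IsLPlusSaturated L M)
    {A : ℕ → Set M} (hA : ∀ i, DefSet1 L M (A i)) (hanti : Antitone A)
    (hne : ∀ i, (A i).Nonempty) : ∃ a, ∀ i, a ∈ A i := by
  have h1 := fun i => Set.definable_iff_finitely_definable.1 (hA i)
  choose F _ hF using h1
  set C : Set M := ⋃ i, (F i : Set M)
  have hCc : C.Countable := Set.countable_iUnion fun i => (F i).countable_toSet
  have hcard : #C ≤ L.card + ℵ₀ := (Cardinal.le_aleph0_iff_set_countable.2 hCc).trans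
    (self_le_add_left _ _)
  have h2 : ∀ i, C.Definable L {v : Fin 1 → M | v 0 ∈ A i} := fun i =>
    (hF i).mono (Set.subset_iUnion (fun i => (F i : Set M)) i)
  choose φ hφ using h2
  have hr : ∀ i a, (φ i).Realize (fun _ : Fin 1 => a) ↔ a ∈ A i := by
    intro i a
    exact (Set.ext_iff.1 (hφ i) fun _ => a).symm
  obtain ⟨a, ha⟩ := hsat C hcard (Set.range φ) (by
    classical
    intro s hs
    obtain ⟨t, ht⟩ : ∃ t : Finset ℕ, ∀ ψ ∈ s, ∃ i ∈ t, φ i = ψ := by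
      choose g hg using fun ψ : s => hs ψ.2
      exact ⟨s.attach.image g, fun ψ hψ => ⟨g ⟨ψ, hψ⟩, by simp, hg ⟨ψ, hψ⟩⟩⟩
    obtain ⟨a, ha⟩ := hne (t.sup id)
    refine ⟨a, fun ψ hψ => ?_⟩
    obtain ⟨i, hi, rfl⟩ := ht ψ hψ
    exact (hr i a).2 (hanti (Finset.le_sup (f := id) hi) ha))
  exact ⟨a, fun i => (hr i a).1 (ha _ ⟨i, rfl⟩)⟩

/-- In an `|L|⁺`-saturated structure, a decreasing sequence of nonempty definable subsets of
`M^n` has a common point. -/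
theorem IsLPlusSaturated.exists_forall_mem (hsat : IsLPlusSaturated L M) {n : ℕ}
    {A : ℕ → Set (Fin n → M)} (hA : ∀ i, DefSet L M (A i)) (hanti : Antitone A)
    (hne : ∀ i, (A i).Nonempty) : ∃ a, ∀ i, a ∈ A i := by
  induction n with
  | zero =>
    refine ⟨Fin.elim0, fun i => ?_⟩
    obtain ⟨a, ha⟩ := hne i
    rwa [Subsingleton.elim Fin.elim0 a]
  | succ n ih =>
    obtain ⟨x, hx⟩ := hsat.exists_forall_mem_one
      (A := fun i => {x | ∃ w : Fin n → M, (Fin.cons x w : Fin (n + 1) → M) ∈ A i})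
      (fun i => by
        refine DefPred.exists_tuple (R := fun (v : Fin 1 → M) (w : Fin n → M) =>
          (Fin.cons (v 0) w : Fin (n + 1) → M) ∈ A i) ?_
        refine (DefPred.comp (P := fun v => v ∈ A i) (hA i)
          (Fin.cons (Sum.inl 0) Sum.inr : Fin (n + 1) → Fin 1 ⊕ Fin n)).congr fun v => ?_
        have : (Fin.cons (v (Sum.inl 0)) (fun b => v (Sum.inr b)) : Fin (n + 1) → M) =
            v ∘ (Fin.cons (Sum.inl 0) Sum.inr : Fin (n + 1) → Fin 1 ⊕ Fin n) := by
          funext i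
          refine Fin.cases ?_ (fun j => ?_) i <;> simp
        rw [this])
      (fun i j hij x ⟨w, hw⟩ => ⟨w, hanti hij hw⟩)
      (fun i => by
        obtain ⟨a, ha⟩ := hne i
        exact ⟨a 0, Fin.tail a, by rwa [Fin.cons_self_tail]⟩)
    obtain ⟨w, hw⟩ := ih (A := fun i => {w | (Fin.cons x w : Fin (n + 1) → M) ∈ A i})
      (fun i => by
        have h : DefPred L fun v : Fin n → M => (fun b => (Fin.cons x v : Fin (n + 1) → M) b)
            ∈ A i := by
          refine DefPred.subst (R := fun v => v ∈ A i) (hA i)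
            (t := fun b v => (Fin.cons x v : Fin (n + 1) → M) b) ?_
          refine Fin.cases ?_ fun j => ?_
          · simpa using DefFun.const x
          · simpa using DefFun.proj j
        exact h)
      (fun i j hij w hw => hanti hij hw) hx
    exact ⟨Fin.cons x w, hw⟩

/-- If the union of a directed definable family is infinite, then so is some member. -/
theorem IsLPlusSaturated.exists_infinite_of_directed (hsat : IsLPlusSaturated L M) {n : ℕ}
    {D : Set (Fin n → M)} (hD : DefSet L M D) (hDne : D.Nonempty) {X : (Fin n → M) → Set M}
    (hX : DefPred L fun v : Fin n ⊕ Fin 1 → M => v (Sum.inr 0) ∈ X fun i => v (Sum.inl i))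
    (hdir : ∀ c ∈ D, ∀ d ∈ D, ∃ e ∈ D, X c ⊆ X e ∧ X d ⊆ X e)
    {Y : Set M} (hY : Y.Infinite) (hYX : ∀ y ∈ Y, ∃ c ∈ D, y ∈ X c) :
    ∃ c ∈ D, (X c).Infinite := by
  obtain ⟨c, hc⟩ := hsat.exists_forall_mem
    (A := fun N => {c | c ∈ D ∧ ∃ x : Fin N → M, (∀ i j, i ≠ j → x i ≠ x j) ∧ ∀ i, x i ∈ X c})
    (fun N => by
      refine DefPred.and (P := fun c => c ∈ D) hD ?_
      refine .exists_tuple (.and ?_ ?_)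
      · exact .forall_finite fun i => .forall_finite fun j =>
          (DefPred.const _).imp (DefPred.eq (.proj _) (.proj _)).not
      · exact .forall_finite fun i => (hX.comp (Sum.map id fun _ => i) :))
    (fun N K hNK c ⟨hc, x, hx, hxc⟩ => ⟨hc, x ∘ Fin.castLE hNK,
      fun i j hij => hx _ _ fun h => hij (Fin.castLE_injective hNK h), fun i => hxc _⟩)
    (fun N => by
      have : Nonempty D := hDne.to_subtype
      have : Infinite Y := hY.to_subtype
      have hdir' : Directed (· ⊆ ·) fun c : D => X c := fun c d => by
        obtain ⟨e, he, h1, h2⟩ := hdir c c.2 d d.2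
        exact ⟨⟨e, he⟩, h1, h2⟩
      let y : Fin N → Y := fun i => Infinite.natEmbedding Y i
      choose g hgD hg using fun i => hYX (y i) (y i).2
      obtain ⟨c, hc⟩ := hdir'.finite_le (fun i => (⟨g i, hgD i⟩ : D))
      refine ⟨c, c.2, fun i => y i, fun i j hij h => hij ?_, fun i => hc i (hg i)⟩
      exact Fin.ext ((Infinite.natEmbedding Y).injective (Subtype.ext h)))
  refine ⟨c, (hc 0).1, fun hfin => ?_⟩
  obtain ⟨-, x, hx, hxc⟩ := hc ((X c).ncard + 1)
  have hinj : Function.Injective x := fun i j h => by_contra fun hij => hx i j hij h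
  have := Set.ncard_le_ncard (Set.range_subset_iff.2 hxc) hfin
  rw [← Set.image_univ, Set.ncard_image_of_injective _ hinj, Set.ncard_univ] at this
  simp at this

/-! ### The uniform space attached to a definable uniform basis -/

open Filter Topology Uniformity

namespace DefUniformBasis

variable (U : DefUniformBasis L M)

theorem refl_mem {c : Fin U.n → M} (hc : c ∈ U.dom) (x : M) : (x, x) ∈ U.ent c :=
  (U.inter_eq_diag x x).2 rfl c hc

/-- The filter basis of entourages. -/
def filterBasis : FilterBasis (M × M) where
  sets := U.ent '' U.dom
  nonempty := U.dom_nonempty.image _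
  inter_sets := by
    rintro _ _ ⟨c, hc, rfl⟩ ⟨d, hd, rfl⟩
    obtain ⟨e, he, h⟩ := U.directed c hc d hd
    exact ⟨_, ⟨e, he, rfl⟩, fun p hp => h p.1 p.2 hp⟩

/-- The uniform structure generated by a definable uniform basis. -/
abbrev uniformSpace : UniformSpace M :=
  UniformSpace.ofCore (UniformSpace.Core.mkOfBasis U.filterBasis
    (by rintro _ ⟨c, hc, rfl⟩ x; exact U.refl_mem hc x)
    (by rintro _ ⟨c, hc, rfl⟩; exact ⟨_, ⟨c, hc, rfl⟩, fun p hp => U.symm c hc p.1 p.2 hp⟩)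
    (by
      rintro _ ⟨c, hc, rfl⟩
      obtain ⟨d, hd, h⟩ := U.comp c hc
      exact ⟨_, ⟨d, hd, rfl⟩, fun p ⟨y, h1, h2⟩ => h p.1 y p.2 h1 h2⟩))

theorem uniformity_hasBasis :
    letI := U.uniformSpace
    (𝓤 M).HasBasis (· ∈ U.dom) U.ent := by
  refine ⟨fun t => ?_⟩
  refine U.filterBasis.mem_filter_iff.trans ⟨?_, ?_⟩
  · rintro ⟨_, ⟨c, hc, rfl⟩, h⟩
    exact ⟨c, hc, h⟩
  · rintro ⟨c, hc, h⟩
    exact ⟨_, ⟨c, hc, rfl⟩, h⟩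

theorem nhds_hasBasis (x : M) :
    letI := U.uniformSpace
    (𝓝 x).HasBasis (· ∈ U.dom) fun c => U.ball c x := by
  let _ := U.uniformSpace
  exact nhds_basis_uniformity' U.uniformity_hasBasis

theorem isOpen1_iff (A : Set M) :
    letI := U.uniformSpace
    U.IsOpen1 A ↔ IsOpen A := by
  let _ := U.uniformSpace
  rw [isOpen_iff_mem_nhds]
  exact forall₂_congr fun x _ => (U.nhds_hasBasis x).mem_iff.symm

theorem t1Space :
    letI := U.uniformSpace
    T1Space M := by
  let _ := U.uniformSpace
  have : T0Space M := t0Space_iff_uniformity.2 fun x y h =>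
    (U.inter_eq_diag x y).1 fun c hc => h _ (U.uniformity_hasBasis.mem_of_mem hc)
  infer_instance

theorem exists_half {c : Fin U.n → M} (hc : c ∈ U.dom) : ∃ d ∈ U.dom, ∀ z x y : M,
    (z, x) ∈ U.ent d → (z, y) ∈ U.ent d → (x, y) ∈ U.ent c := by
  obtain ⟨d, hd, h⟩ := U.comp c hc
  exact ⟨d, hd, fun z x y hx hy => h x z y (U.symm d hd z x hx) hy⟩

theorem exists_le {c d : Fin U.n → M} (hc : c ∈ U.dom) (hd : d ∈ U.dom) :
    ∃ e ∈ U.dom, U.ent e ⊆ U.ent c ∧ U.ent e ⊆ U.ent d := by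
  obtain ⟨e, he, h⟩ := U.directed c hc d hd
  exact ⟨e, he, fun p hp => (h p.1 p.2 hp).1, fun p hp => (h p.1 p.2 hp).2⟩

section DefPred

variable {α : Type}

theorem defPred_ent {s t : (α → M) → M} {c : (α → M) → Fin U.n → M} (hs : DefFun L s)
    (ht : DefFun L t) (hc : ∀ i, DefFun L fun v => c v i) :
    DefPred L fun v => (s v, t v) ∈ U.ent (c v) := by
  have h := DefPred.subst (R := fun w => w ∈ U.phi) U.phi_def
    (t := Sum.elim ![s, t] fun i v => c v i) (by
      rintro (i | i)
      · revert i
        simp [Fin.forall_fin_two, hs, ht]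
      · exact hc i)
  refine h.congr fun v => ?_
  have : Sum.elim ![s v, t v] (c v) =
      fun b => (Sum.elim ![s, t] fun i v => c v i : Fin 2 ⊕ Fin U.n → (α → M) → M) b v := by
    funext b
    rcases b with b | b
    · revert b
      simp [Fin.forall_fin_two]
    · rfl
  change Sum.elim ![s v, t v] (c v) ∈ U.phi ↔ _
  rw [this]

theorem defPred_exists_dom {R : (α → M) → (Fin U.n → M) → Prop}
    (h : DefPred L fun v : α ⊕ Fin U.n → M =>
      R (fun a => v (Sum.inl a)) (fun b => v (Sum.inr b))) :
    DefPred L fun v => ∃ c ∈ U.dom, R v c :=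
  .exists_tuple (.and (DefPred.comp (P := fun c => c ∈ U.dom) U.dom_def Sum.inr) h)

theorem defPred_forall_dom {R : (α → M) → (Fin U.n → M) → Prop}
    (h : DefPred L fun v : α ⊕ Fin U.n → M =>
      R (fun a => v (Sum.inl a)) (fun b => v (Sum.inr b))) :
    DefPred L fun v => ∀ c ∈ U.dom, R v c :=
  .forall_tuple (.imp (DefPred.comp (P := fun c => c ∈ U.dom) U.dom_def Sum.inr) h)

theorem defPred_eventually {R : (α → M) → M → Prop} {t : (α → M) → M}
    (h : DefPred L fun v : α ⊕ Fin 1 → M => R (fun a => v (Sum.inl a)) (v (Sum.inr 0)))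
    (ht : DefFun L t) :
    letI := U.uniformSpace
    DefPred L fun v => ∀ᶠ y in 𝓝 (t v), R v y := by
  let _ := U.uniformSpace
  refine DefPred.congr (P := fun v => ∃ c ∈ U.dom, ∀ y, (t v, y) ∈ U.ent c → R v y) ?_
    fun v => (U.nhds_hasBasis (t v)).eventually_iff
  refine U.defPred_exists_dom (.forall (.imp (U.defPred_ent ?_ (.proj _) fun i => .proj _) ?_))
  · exact (DefPred.comp ht (Sum.map (fun a => Sum.inl (Sum.inl a)) id) :)
  · exact (h.comp (Sum.map Sum.inl id) :)

end DefPred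

end DefUniformBasis

/-! ### Generic behaviour of definable functions -/

namespace Setting

variable (S : Setting L M)

theorem infinite_of_mem_nhds {x : M} {A : Set M}
    (hA : letI := S.toDefUniformBasis.uniformSpace; A ∈ 𝓝 x) : A.Infinite := by
  let _ := S.toDefUniformBasis.uniformSpace
  have := S.toDefUniformBasis.t1Space
  have : NeBot (𝓝[≠] x) := by
    rw [← mem_closure_iff_nhdsWithin_neBot, mem_closure_iff_nhds_basis
      (S.toDefUniformBasis.nhds_hasBasis x)]
    exact fun c hc => S.noIsolated x c hc
  exact _root_.infinite_of_mem_nhds x hA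

theorem exists_mem_nhds {A : Set M} (hA : DefSet1 L M A) (hinf : A.Infinite) :
    letI := S.toDefUniformBasis.uniformSpace
    ∃ x ∈ A, A ∈ 𝓝 x := by
  let _ := S.toDefUniformBasis.uniformSpace
  obtain ⟨x, c, hc, h⟩ := S.infInterior A hA hinf
  have : A ∈ 𝓝 x := (S.toDefUniformBasis.nhds_hasBasis x).mem_iff.2 ⟨c, hc, h⟩
  exact ⟨x, mem_of_mem_nhds this, this⟩

theorem exists_infinite_of_directed {X : (Fin S.n → M) → Set M}
    (hX : DefPred L fun v : Fin S.n ⊕ Fin 1 → M => v (Sum.inr 0) ∈ X fun i => v (Sum.inl i))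
    (hmono : ∀ c ∈ S.dom, ∀ d ∈ S.dom, S.ent d ⊆ S.ent c → X c ⊆ X d)
    {Y : Set M} (hY : Y.Infinite) (hYX : ∀ y ∈ Y, ∃ c ∈ S.dom, y ∈ X c) :
    ∃ c ∈ S.dom, DefSet1 L M (X c) ∧ (X c).Infinite := by
  obtain ⟨c, hc, hinf⟩ := S.saturated.exists_infinite_of_directed S.dom_def S.dom_nonempty hX
    (fun c hc d hd => by
      obtain ⟨e, he, h1, h2⟩ := S.exists_le hc hd
      exact ⟨e, he, hmono c hc e he h1, hmono d hd e he h2⟩) hY hYX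
  refine ⟨c, hc, ?_, hinf⟩
  have := DefPred.subst hX (α := Fin 1) (t := Sum.elim (fun i _ => c i) fun j v => v j) (by
    rintro (i | i)
    · exact .const _
    · exact .proj _)
  exact this

variable {f : M → M}

/-- A definable function is continuous outside a finite set. -/
theorem finite_not_continuousAt
    (hf : DefPred L fun v : Fin 2 → M => f (v 0) = v 1) :
    letI := S.toDefUniformBasis.uniformSpace
    {x | ¬ ContinuousAt f x}.Finite := by
  let _ := S.toDefUniformBasis.uniformSpace
  by_contra hinf
  obtain ⟨c, hc, hdef, hXinf⟩ := S.exists_infinite_of_directed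
    (X := fun c => {x | ¬ ∀ᶠ y in 𝓝 x, (f x, f y) ∈ S.ent c})
    (.not (S.defPred_eventually (S.defPred_ent (.comp_graph hf (.proj _))
      (.comp_graph hf (.proj _)) fun _ => .proj _) (.proj _)))
    (fun c hc d hd hcd x hx h => hx (h.mono fun y hy => hcd hy)) hinf
    (fun x hx => by
      by_contra h
      refine hx ((S.nhds_hasBasis (f x)).tendsto_right_iff.2 fun c hc => ?_)
      exact by_contra fun hxc => h ⟨c, hc, hxc⟩)
  set X := {x | ¬ ∀ᶠ y in 𝓝 x, (f x, f y) ∈ S.ent c}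
  obtain ⟨d, hd, hdc⟩ := S.exists_half hc
  have hball : ∀ z, (X ∩ f ⁻¹' S.ball d z).Finite := by
    intro z
    by_contra hi
    obtain ⟨x, hx, hxn⟩ := S.exists_mem_nhds (A := X ∩ f ⁻¹' S.ball d z)
      (DefPred.and (P := fun v : Fin 1 → M => v 0 ∈ X) hdef
        (S.defPred_ent (.const z) (.comp_graph hf (.proj _)) fun i => .const (d i))) hi
    exact hx.1 (mem_of_superset hxn fun y hy => hdc z _ _ hx.2 hy.2)
  have himg : (f '' X).Infinite := by
    intro hfin
    refine hXinf (Set.Finite.of_finite_fibers f hfin fun z _ => ?_)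
    refine (hball z).subset fun x hx => ⟨hx.1, ?_⟩
    have h2 : f x = z := hx.2
    change (z, f x) ∈ S.ent d
    rw [h2]
    exact S.refl_mem hd z
  obtain ⟨z, -, hz⟩ := S.exists_mem_nhds (defSet1_image hf hdef) himg
  refine S.infinite_of_mem_nhds (inter_mem hz ((S.nhds_hasBasis z).mem_of_mem hd))
    (((hball z).image f).subset ?_)
  rintro _ ⟨⟨x, hx, rfl⟩, hxz⟩
  exact ⟨x, ⟨hx, hxz⟩, rfl⟩

/-- A definable function is locally constant or locally injective outside a finite set. -/
theorem finite_not_locally_const_or_injective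
    (hf : DefPred L fun v : Fin 2 → M => f (v 0) = v 1) :
    letI := S.toDefUniformBasis.uniformSpace
    {x | ¬ (∀ᶠ y in 𝓝 x, f y = f x) ∧ ¬ ∃ V ∈ 𝓝 x, Set.InjOn f V}.Finite := by
  let _ := S.toDefUniformBasis.uniformSpace
  set Y := {x | ¬ (∀ᶠ y in 𝓝 x, f y = f x) ∧ ¬ ∃ V ∈ 𝓝 x, Set.InjOn f V}
  by_contra hinf
  have hY : DefSet1 L M Y := by
    refine DefPred.congr (P := fun v : Fin 1 → M => ¬ (∀ᶠ y in 𝓝 (v 0), f y = f (v 0)) ∧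
      ¬ ∃ c ∈ S.dom, ∀ y, (v 0, y) ∈ S.ent c → ∀ z, (v 0, z) ∈ S.ent c → f y = f z → y = z)
      ?_ fun v => ?_
    · refine .and (.not (S.defPred_eventually (.eq (.comp_graph hf (.proj _))
        (.comp_graph hf (.proj _))) (.proj _))) (.not (S.defPred_exists_dom ?_))
      refine .forall (.imp (S.defPred_ent (.proj _) (.proj _) fun _ => .proj _) ?_)
      refine .forall (.imp (S.defPred_ent (.proj _) (.proj _) fun _ => .proj _) ?_)
      exact .imp (.eq (.comp_graph hf (.proj _)) (.comp_graph hf (.proj _)))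
        (.eq (.proj _) (.proj _))
    · refine and_congr Iff.rfl (not_congr ⟨?_, ?_⟩)
      · rintro ⟨V, hV, hinj⟩
        obtain ⟨c, hc, h⟩ := (S.nhds_hasBasis _).mem_iff.1 hV
        exact ⟨c, hc, fun y hy z hz => hinj (h hy) (h hz)⟩
      · rintro ⟨c, hc, h⟩
        exact ⟨_, (S.nhds_hasBasis _).mem_of_mem hc, fun y hy z hz => h y hy z hz⟩
  have hfib : ∀ z, {x | x ∈ Y ∧ f x = z}.Finite := by
    intro z
    by_contra hi
    obtain ⟨x, hx, hxn⟩ := S.exists_mem_nhds (A := {x | x ∈ Y ∧ f x = z})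
      (DefPred.and (P := fun v : Fin 1 → M => v 0 ∈ Y) hY
        (.eq (.comp_graph hf (.proj 0)) (.const z))) hi
    exact hx.1.1 (mem_of_superset hxn fun y hy => hy.2.trans hx.2.symm)
  obtain ⟨c, hc, hdef, hXinf⟩ := S.exists_infinite_of_directed
    (X := fun c => {x | x ∈ Y ∧ ∀ y, y ∈ Y → (x, y) ∈ S.ent c → f x = f y → x = y})
    (.and (.mem_set1 hY (.proj _)) (.forall (.imp (.mem_set1 hY (.proj _))
      (.imp (S.defPred_ent (.proj _) (.proj _) fun _ => .proj _)
        (.imp (.eq (.comp_graph hf (.proj _)) (.comp_graph hf (.proj _)))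
          (.eq (.proj _) (.proj _)))))))
    (fun c hc d hd hcd x hx => ⟨hx.1, fun y hy hxy => hx.2 y hy (hcd hxy)⟩) hinf
    (fun x hx => by
      have := S.t1Space
      have hfin : {y | (y ∈ Y ∧ f y = f x) ∧ y ≠ x}.Finite :=
        (hfib (f x)).subset fun y hy => hy.1
      obtain ⟨c, hc, h⟩ := (S.nhds_hasBasis x).mem_iff.1
        (hfin.isClosed.isOpen_compl.mem_nhds (x := x) fun h => h.2 rfl)
      exact ⟨c, hc, hx, fun y hy hxy hfy => by_contra fun hne =>
        h hxy ⟨⟨hy, hfy.symm⟩, Ne.symm hne⟩⟩)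
  obtain ⟨x, hx, hxn⟩ := S.exists_mem_nhds hdef hXinf
  obtain ⟨d, hd, hdc⟩ := S.exists_half hc
  refine hx.1.2 ⟨_, inter_mem hxn ((S.nhds_hasBasis x).mem_of_mem hd), ?_⟩
  exact fun y hy z hz hyz => hy.1.2 z hz.1.1 (hdc x y z hy.2 hz.2) hyz

/-- A definable function is open at all but finitely many of the points at which it is locally
injective. -/
theorem finite_not_open
    (hf : DefPred L fun v : Fin 2 → M => f (v 0) = v 1) :
    letI := S.toDefUniformBasis.uniformSpace
    {x | (∃ V ∈ 𝓝 x, Set.InjOn f V) ∧ ¬ ∀ c ∈ S.dom, f '' S.ball c x ∈ 𝓝 (f x)}.Finite := by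
  let _ := S.toDefUniformBasis.uniformSpace
  by_contra hinf
  obtain ⟨c, hc, hdef, hXinf⟩ := S.exists_infinite_of_directed
    (X := fun c => {x | (∃ d ∈ S.dom, ∀ y, (x, y) ∈ S.ent d → ∀ z, (x, z) ∈ S.ent d →
      f y = f z → y = z) ∧ ¬ ∀ᶠ z in 𝓝 (f x), ∃ y, (x, y) ∈ S.ent c ∧ f y = z})
    (by
      refine .and (S.defPred_exists_dom ?_) (.not (S.defPred_eventually (.exists (.and
        (S.defPred_ent (.proj _) (.proj _) fun _ => .proj _)
        (.eq (.comp_graph hf (.proj _)) (.proj _)))) (.comp_graph hf (.proj _))))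
      refine .forall (.imp (S.defPred_ent (.proj _) (.proj _) fun _ => .proj _) ?_)
      refine .forall (.imp (S.defPred_ent (.proj _) (.proj _) fun _ => .proj _) ?_)
      exact .imp (.eq (.comp_graph hf (.proj _)) (.comp_graph hf (.proj _)))
        (.eq (.proj _) (.proj _)))
    (fun c hc d hd hcd x hx => ⟨hx.1, fun h => hx.2 (h.mono fun z ⟨y, hy, hyz⟩ =>
      ⟨y, hcd hy, hyz⟩)⟩) hinf
    (fun x ⟨⟨V, hV, hinj⟩, hx⟩ => by
      push Not at hx
      obtain ⟨c, hc, hcx⟩ := hx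
      obtain ⟨d, hd, hdV⟩ := (S.nhds_hasBasis x).mem_iff.1 hV
      exact ⟨c, hc, ⟨d, hd, fun y hy z hz => hinj (hdV hy) (hdV hz)⟩, hcx⟩)
  obtain ⟨x, ⟨⟨d, hd, hinj⟩, -⟩, hxn⟩ := S.exists_mem_nhds hdef hXinf
  obtain ⟨e, he, hec⟩ := S.exists_half hc
  obtain ⟨b, hb, hbsub⟩ := (S.nhds_hasBasis x).mem_iff.1
    (inter_mem hxn (inter_mem ((S.nhds_hasBasis x).mem_of_mem hd)
      ((S.nhds_hasBasis x).mem_of_mem he)))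
  have hbdef : DefSet1 L M (S.ball b x) :=
    S.defPred_ent (.const x) (.proj _) fun i => .const (b i)
  have hbinf : (S.ball b x).Infinite := S.infinite_of_mem_nhds ((S.nhds_hasBasis x).mem_of_mem hb)
  have hbinj : Set.InjOn f (S.ball b x) := fun y hy z hz =>
    hinj y (hbsub hy).2.1 z (hbsub hz).2.1
  obtain ⟨_, ⟨y, hy, rfl⟩, hyn⟩ :=
    S.exists_mem_nhds (defSet1_image hf hbdef) (hbinf.image hbinj)
  refine (hbsub hy).1.2 (mem_of_superset hyn ?_)
  rintro _ ⟨z, hz, rfl⟩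
  exact ⟨z, hec x y z (hbsub hy).2.2 (hbsub hz).2.2, rfl⟩

end Setting

/-- For a definable `f : M → M`, all but finitely many `p ∈ M` have an open
neighborhood `V` on which `f` is constant, or such that `f(V)` is open and `f` restricted to
`V` is a homeomorphism onto its image. -/
theorem statement8 (S : Setting L M) (f : M → M)
    (hf : DefSet L M {v : Fin 2 → M | f (v 0) = v 1}) :
    {p : M | ¬ ∃ V : Set M, S.toDefUniformBasis.IsOpen1 V ∧ p ∈ V ∧
      ((∀ x ∈ V, ∀ y ∈ V, f x = f y) ∨
        (S.toDefUniformBasis.IsOpen1 (f '' V) ∧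
          S.toDefUniformBasis.Homeo1Onto f V))}.Finite := by
  let _ := S.toDefUniformBasis.uniformSpace
  have := S.toDefUniformBasis.t1Space
  set F : Set M := {x | ¬ ContinuousAt f x} ∪
    ({x | ¬ (∀ᶠ y in 𝓝 x, f y = f x) ∧ ¬ ∃ V ∈ 𝓝 x, Set.InjOn f V} ∪
      {x | (∃ V ∈ 𝓝 x, Set.InjOn f V) ∧ ¬ ∀ c ∈ S.dom, f '' S.ball c x ∈ 𝓝 (f x)})
  have hFfin : F.Finite := (S.finite_not_continuousAt hf).union
    ((S.finite_not_locally_const_or_injective hf).union (S.finite_not_open hf))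
  refine hFfin.subset fun p hp => by_contra fun hpF => hp ?_
  by_cases hconst : ∀ᶠ y in 𝓝 p, f y = f p
  · refine ⟨interior {y | f y = f p}, (S.isOpen1_iff _).2 isOpen_interior,
      mem_interior_iff_mem_nhds.2 hconst, Or.inl fun x hx y hy => ?_⟩
    have h {x} (hx : x ∈ interior {y | f y = f p}) : x ∈ {y | f y = f p} := interior_subset hx
    exact (h hx).trans (h hy).symm
  obtain ⟨V₀, hV₀, hinj⟩ : ∃ V ∈ 𝓝 p, Set.InjOn f V :=
    by_contra fun h => hpF (Or.inr (Or.inl ⟨hconst, h⟩))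
  set V := interior V₀ ∩ (F \ {p})ᶜ
  have hVo : IsOpen V := isOpen_interior.inter (hFfin.sdiff).isClosed.isOpen_compl
  have hpV : p ∈ V := ⟨mem_interior_iff_mem_nhds.2 hV₀, fun h => h.2 rfl⟩
  have hVF : ∀ x ∈ V, x ∉ F := by
    intro x hx hxF
    rcases eq_or_ne x p with rfl | hne
    · exact hpF hxF
    · exact hx.2 ⟨hxF, hne⟩
  have hVinj : Set.InjOn f V := hinj.mono fun x hx => interior_subset hx.1
  have hcont : ∀ x ∈ V, ContinuousAt f x := fun x hx =>
    by_contra fun h => hVF x hx (Or.inl h)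
  have hopen : ∀ x ∈ V, ∀ W ∈ 𝓝 x, f '' W ∈ 𝓝 (f x) := by
    intro x hx W hW
    obtain ⟨c, hc, hcW⟩ := (S.nhds_hasBasis x).mem_iff.1 hW
    have h : ∀ c ∈ S.dom, f '' S.ball c x ∈ 𝓝 (f x) :=
      by_contra fun h => hVF x hx (Or.inr (Or.inr ⟨⟨V, hVo.mem_nhds hx, hVinj⟩, h⟩))
    exact mem_of_superset (h c hc) (Set.image_mono hcW)
  refine ⟨V, (S.isOpen1_iff _).2 hVo, hpV, Or.inr ⟨(S.isOpen1_iff _).2 ?_, hVinj, ?_, ?_⟩⟩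
  · rw [isOpen_iff_mem_nhds]
    rintro _ ⟨x, hx, rfl⟩
    exact hopen x hx V (hVo.mem_nhds hx)
  · intro x hx c hc
    obtain ⟨d, hd, h⟩ := (S.nhds_hasBasis x).mem_iff.1
      (hcont x hx ((S.nhds_hasBasis (f x)).mem_of_mem hc))
    exact ⟨d, hd, fun y _ hy => h hy⟩
  · intro x hx c hc
    obtain ⟨d, hd, h⟩ := (S.nhds_hasBasis (f x)).mem_iff.1
      (hopen x hx _ (inter_mem (hVo.mem_nhds hx) ((S.nhds_hasBasis x).mem_of_mem hc)))
    refine ⟨d, hd, fun y hy hyd => ?_⟩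
    obtain ⟨z, hz, hzy⟩ := h hyd
    rw [← hVinj hz.1 hy hzy]
    exact hz.2

end DpTame
end

section
/- Exactly one of the following holds: (1) there is a non-empty definable open U ⊆ M and a locally constant correspondence U ⇉ M with infinite image; or (2) algebraic closure acl satisfies the exchange property on M. -/
namespace DpTame

open FirstOrder Set Cardinal

universe u

variable {L : FirstOrder.Language.{u, u}} {M : Type u} [L.Structure M]

section Definability

variable {α : Type} {C : Set M}

theorem definable_exists {P : (α → M) → M → Prop}
    (h : C.Definable L {w : α ⊕ Fin 1 → M | P (w ∘ Sum.inl) (w (Sum.inr 0))}) :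
    C.Definable L {v : α → M | ∃ y, P v y} := by
  convert h.exists_of_finite using 1
  ext v
  exact ⟨fun ⟨y, hy⟩ => ⟨fun _ => y, hy⟩, fun ⟨u, hu⟩ => ⟨u 0, hu⟩⟩

theorem definable_forall {P : (α → M) → M → Prop}
    (h : C.Definable L {w : α ⊕ Fin 1 → M | P (w ∘ Sum.inl) (w (Sum.inr 0))}) :
    C.Definable L {v : α → M | ∀ y, P v y} := by
  convert h.forall_of_finite using 1
  ext v
  exact ⟨fun H u => H (u 0), fun H y => H (fun _ => y)⟩

theorem definable_imp {P Q : (α → M) → Prop} (hP : C.Definable L {v | P v})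
    (hQ : C.Definable L {v | Q v}) : C.Definable L {v | P v → Q v} :=
  hP.himp hQ

theorem definable_and {P Q : (α → M) → Prop} (hP : C.Definable L {v | P v})
    (hQ : C.Definable L {v | Q v}) : C.Definable L {v | P v ∧ Q v} :=
  hP.inter hQ

theorem definable_pair {G : Set (M × M)} (h : C.Definable₂ L G) (i j : α) :
    C.Definable L {v : α → M | (v i, v j) ∈ G} :=
  h.preimage_comp ![i, j]

theorem definable_coord {A : Set M} (h : C.Definable₁ L A) (i : α) :
    C.Definable L {v : α → M | v i ∈ A} :=
  h.preimage_comp ![i]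

/-- The number of solutions being at least a given number is a definable condition. -/
theorem definable_le_encard {R : Set (α ⊕ Fin 1 → M)} (hR : C.Definable L R) (N : ℕ) :
    C.Definable L {v : α → M | (N : ℕ∞) ≤ {x | Sum.elim v (fun _ => x) ∈ R}.encard} := by
  have hinj : C.Definable L {w : α ⊕ Fin N → M | ∀ p : Fin N × Fin N,
      w (Sum.inr p.1) = w (Sum.inr p.2) → p.1 = p.2} := by
    rw [ofPred_forall]
    refine definable_iInter_of_finite fun p => definable_imp ?_ ?_
    · exact definable_pair (Set.Definable.diagonal L C) (Sum.inr p.1) (Sum.inr p.2)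
    · by_cases h : p.1 = p.2 <;> simp [h]
  have hmem : C.Definable L {w : α ⊕ Fin N → M | ∀ i : Fin N,
      Sum.elim (w ∘ Sum.inl) (fun _ => w (Sum.inr i)) ∈ R} := by
    rw [ofPred_forall]
    refine definable_iInter_of_finite fun i => ?_
    convert hR.preimage_comp (Sum.elim Sum.inl fun _ => Sum.inr i : α ⊕ Fin 1 → α ⊕ Fin N) using 1
    ext w
    simp only [mem_ofPred_eq, mem_preimage, Sum.comp_elim]
    rfl
  convert (definable_and hinj hmem).exists_of_finite using 1
  ext v
  simp only [mem_ofPred_eq, Sum.elim_inr, Sum.elim_comp_inl, Prod.forall]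
  constructor
  · intro h
    obtain ⟨t, ht, htN⟩ := exists_subset_encard_eq h
    have hf : t.Finite := finite_of_encard_eq_coe htN
    have hc : Nat.card t = N := by
      rw [Nat.card_coe_set_eq, ncard, htN]
      rfl
    have := hf.to_subtype
    let e := (Finite.equivFinOfCardEq hc).symm
    exact ⟨fun i => e i, fun i j hij => e.injective (Subtype.ext hij), fun i => ht (e i).2⟩
  · rintro ⟨u, hu, hm⟩
    have hu' : Function.Injective u := fun i j => hu i j
    calc (N : ℕ∞) = (range u).encard := by
            rw [← image_univ, hu'.encard_image, encard_univ]
            simp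
      _ ≤ _ := encard_le_encard (by rintro _ ⟨i, rfl⟩; exact hm i)

theorem definable_le_encard_left {G : Set (M × M)} (hG : C.Definable₂ L G) (N : ℕ) :
    C.Definable₁ L {y | (N : ℕ∞) ≤ {x | (x, y) ∈ G}.encard} :=
  definable_le_encard (α := Fin 1) (definable_pair hG (Sum.inr 0) (Sum.inl 0)) N

theorem definable_le_encard_right {G : Set (M × M)} (hG : C.Definable₂ L G) (N : ℕ) :
    C.Definable₁ L {x | (N : ℕ∞) ≤ {y | (x, y) ∈ G}.encard} :=
  definable_le_encard (α := Fin 1) (definable_pair hG (Sum.inl 0) (Sum.inr 0)) N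

/-- A fiber of a `C`-definable relation is definable over `C` and the base point. -/
theorem definable_fiber {G : Set (M × M)} (hG : C.Definable₂ L G) (b : M) :
    (C ∪ {b}).Definable₁ L {x | (x, b) ∈ G} := by
  have h1 : (C ∪ {b}).Definable L {v : Fin 1 → M | ∃ y, (v 0, y) ∈ G ∧ y ∈ ({b} : Set M)} :=
    definable_exists <| definable_and
      (definable_pair (hG.mono subset_union_left) (Sum.inl 0) (Sum.inr 0))
      (definable_coord (Set.Definable.singleton_of_mem L (Or.inr rfl)) (Sum.inr 0))
  simpa [Definable₁] using h1

/-- A set definable over `K ∪ {a}` is the fiber over `a` of a relation definable over `K`. -/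
theorem exists_definable_fiber_eq {K : Set M} {a : M} {A : Set M}
    (hA : (K ∪ {a}).Definable₁ L A) :
    ∃ H : Set (M × M), K.Definable₂ L H ∧ A = {y | (a, y) ∈ H} := by
  classical
  obtain ⟨φ, hφ⟩ := definable_iff_exists_formula_sum.1 hA
  let f : ↥(K ∪ {a}) ⊕ Fin 1 → K ⊕ Fin 2 :=
    Sum.elim (fun t => if h : (t : M) ∈ K then Sum.inl ⟨t, h⟩ else Sum.inr 0) (fun _ => Sum.inr 1)
  refine ⟨{p | φ.Realize (Sum.elim (↑) ![p.1, p.2] ∘ f)}, ?_, ?_⟩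
  · refine definable_iff_exists_formula_sum.2 ⟨φ.relabel f, ?_⟩
    ext v
    have : ![v 0, v 1] = v := by
      ext i
      fin_cases i <;> rfl
    simp [Language.Formula.realize_relabel, this]
  · ext y
    have h1 : y ∈ A ↔ (fun _ => y : Fin 1 → M) ∈ {x : Fin 1 → M | x 0 ∈ A} := Iff.rfl
    rw [h1, hφ, mem_ofPred_eq, mem_ofPred_eq, mem_ofPred_eq]
    congr! 1
    ext t
    rcases t with ⟨t, ht⟩ | t
    · by_cases h : t ∈ K
      · simp [f, h]
      · obtain rfl : t = a := ht.resolve_left h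
        simp [f, h]
    · simp [f]

end Definability

section Algebraic

variable {C : Set M}

theorem mem_aclOf_iff {a : M} :
    a ∈ aclOf L M C ↔ ∃ A : Set M, C.Definable₁ L A ∧ A.Finite ∧ a ∈ A := by
  constructor
  · rintro ⟨S, hS, hf, ha⟩
    refine ⟨{x | (fun _ => x) ∈ S}, ?_, hf.preimage fun x _ y _ h => congrFun h 0, ha⟩
    have : {v : Fin 1 → M | (fun _ => v 0) ∈ S} = S := by
      ext v
      have : (fun _ => v 0) = v := by
        ext i
        rw [Subsingleton.elim i 0]
      simp [this]
    exact this ▸ hS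
  · rintro ⟨A, hA, hf, ha⟩
    refine ⟨_, hA, hf.preimage (f := fun v : Fin 1 → M => v 0) fun v _ w _ h => ?_, ha⟩
    ext i
    rw [Subsingleton.elim i 0]
    exact h

theorem aclOf_mono {D : Set M} (h : C ⊆ D) : aclOf L M C ⊆ aclOf L M D :=
  fun _ ⟨S, hS, hf, ha⟩ => ⟨S, hS.mono h, hf, ha⟩

theorem subset_aclOf : C ⊆ aclOf L M C := fun a ha =>
  mem_aclOf_iff.2 ⟨{a}, Set.Definable.singleton_of_mem L ha, finite_singleton a, rfl⟩

/-- Saturation in terms of definable sets with the finite intersection property. -/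
theorem IsLPlusSaturated.exists_mem (hs : IsLPlusSaturated L M) (hC : C.Finite)
    {F : Set (Set M)} (hF : ∀ A ∈ F, C.Definable₁ L A)
    (hfip : ∀ s ⊆ F, s.Finite → ∃ a, ∀ A ∈ s, a ∈ A) : ∃ a, ∀ A ∈ F, a ∈ A := by
  obtain ⟨a, ha⟩ := hs C (hC.lt_aleph0.le.trans (self_le_add_left _ _))
    {φ | {x : M | φ.Realize fun _ => x} ∈ F} fun s hsF => by
      obtain ⟨a, ha⟩ := hfip
        ((fun φ : (L[[C]]).Formula (Fin 1) => {x : M | φ.Realize fun _ => x}) '' s)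
        (by rintro _ ⟨φ, hφ, rfl⟩; exact hsF hφ) (s.finite_toSet.image _)
      exact ⟨a, fun φ hφ => ha _ ⟨φ, hφ, rfl⟩⟩
  refine ⟨a, fun A hA => ?_⟩
  obtain ⟨φ, hφ⟩ := hF A hA
  have hAφ : A = {x : M | φ.Realize fun _ => x} := by
    ext x
    have := congrArg (fun S : Set (Fin 1 → M) => (fun _ => x) ∈ S) hφ
    exact iff_of_eq this
  have hm := ha φ (show _ ∈ F from hAφ ▸ hA)
  rw [hAφ]
  exact hm

/-- A decreasing sequence of infinite definable sets has a common non-algebraic point. -/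
theorem IsLPlusSaturated.exists_notMem_aclOf (hs : IsLPlusSaturated L M) (hC : C.Finite)
    {Y : ℕ → Set M} (hY : Antitone Y) (hd : ∀ N, C.Definable₁ L (Y N))
    (hinf : ∀ N, (Y N).Infinite) : ∃ a ∉ aclOf L M C, ∀ N, a ∈ Y N := by
  obtain ⟨a, ha⟩ := hs.exists_mem hC (F := {A | C.Definable₁ L A ∧ ∃ N, (Y N \ A).Finite})
    (fun A hA => hA.1) fun s hsF hsf => by
      have key : ∃ N, (Y N \ ⋂₀ s).Finite := by
        induction s, hsf using Set.Finite.induction_on with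
        | empty => exact ⟨0, by simp⟩
        | @insert A s _ _ ih =>
          obtain ⟨N, hN⟩ := ih ((subset_insert A s).trans hsF)
          obtain ⟨N', hN'⟩ := (hsF (mem_insert A s)).2
          refine ⟨max N N', (hN.union hN').subset ?_⟩
          rw [sInter_insert, sdiff_inter]
          exact union_subset
            ((sdiff_subset_sdiff_left (hY (le_max_right N N'))).trans subset_union_right)
            ((sdiff_subset_sdiff_left (hY (le_max_left N N'))).trans subset_union_left)
      obtain ⟨N, hN⟩ := key
      obtain ⟨a, ha, hna⟩ := ((hinf N).sdiff hN).nonempty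
      refine ⟨a, fun A hA => ?_⟩
      by_contra h
      exact hna ⟨ha, fun h' => h (h' A hA)⟩
  refine ⟨a, fun hacl => ?_, fun N => ha _ ⟨hd N, N, by simp⟩⟩
  obtain ⟨A, hA, hf, haA⟩ := mem_aclOf_iff.1 hacl
  exact ha Aᶜ ⟨hA.compl, 0, hf.subset fun x hx => not_not.1 hx.2⟩ haA

theorem infinite_of_notMem_aclOf {A : Set M} {a : M} (hA : C.Definable₁ L A) (ha : a ∈ A)
    (h : a ∉ aclOf L M C) : A.Infinite :=
  fun hf => h (mem_aclOf_iff.2 ⟨A, hA, hf, ha⟩)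

end Algebraic

namespace DefUniformBasis

variable (U : DefUniformBasis L M)

theorem mem_ball_self {c : Fin U.n → M} (hc : c ∈ U.dom) (x : M) : x ∈ U.ball c x :=
  (U.inter_eq_diag x x).2 rfl c hc

theorem exists_ball_subset_inter {c d : Fin U.n → M} (hc : c ∈ U.dom) (hd : d ∈ U.dom) :
    ∃ e ∈ U.dom, ∀ x, U.ball e x ⊆ U.ball c x ∩ U.ball d x := by
  obtain ⟨e, he, h⟩ := U.directed c hc d hd
  exact ⟨e, he, fun x y hy => h x y hy⟩

theorem exists_ball_ball_subset {c : Fin U.n → M} (hc : c ∈ U.dom) :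
    ∃ d ∈ U.dom, U.ball d ≤ U.ball c ∧ ∀ x, ∀ y ∈ U.ball d x, U.ball d y ⊆ U.ball c x := by
  obtain ⟨d, hd, h⟩ := U.comp c hc
  exact ⟨d, hd, fun x y hy => h x y y hy (U.mem_ball_self hd y), fun x y hy z hz => h x y z hy hz⟩

theorem isOpen1_interior1 (A : Set M) : U.IsOpen1 (U.interior1 A) := by
  rintro x ⟨c, hc, hcA⟩
  obtain ⟨d, hd, -, h⟩ := U.exists_ball_ball_subset hc
  exact ⟨d, hd, fun y hy => ⟨d, hd, (h x y hy).trans hcA⟩⟩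

theorem interior1_subset (A : Set M) : U.interior1 A ⊆ A := by
  rintro x ⟨c, hc, hcA⟩
  exact hcA (U.mem_ball_self hc x)

theorem exists_ball_forall_of_finite {ι : Type*} {s : Set ι} (hs : s.Finite) {A : ι → Set M}
    {x : M} (h : ∀ i ∈ s, ∃ c ∈ U.dom, U.ball c x ⊆ A i) :
    ∃ c ∈ U.dom, ∀ i ∈ s, U.ball c x ⊆ A i := by
  induction s, hs using Set.Finite.induction_on with
  | empty => exact U.dom_nonempty.imp fun c hc => ⟨hc, by simp⟩
  | @insert i s _ _ ih =>
    obtain ⟨c, hc, hcA⟩ := ih fun j hj => h j (mem_insert_of_mem i hj)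
    obtain ⟨d, hd, hdA⟩ := h i (mem_insert i s)
    obtain ⟨e, he, hecd⟩ := U.exists_ball_subset_inter hc hd
    refine ⟨e, he, ?_⟩
    rintro j (rfl | hj)
    · exact fun y hy => hdA (hecd x hy).2
    · exact fun y hy => hcA j hj (hecd x hy).1

theorem ball_infinite (hU : ∀ x : M, ∀ c ∈ U.dom, ∃ y, y ≠ x ∧ y ∈ U.ball c x)
    {c : Fin U.n → M} (hc : c ∈ U.dom) (x : M) : (U.ball c x).Infinite := by
  intro hf
  obtain ⟨d, hd, hdA⟩ := U.exists_ball_forall_of_finite (hf.sdiff (t := {x}))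
    (A := fun y => {y}ᶜ) (x := x) fun y hy => by
      have := mt (U.inter_eq_diag x y).1 (Ne.symm hy.2)
      push Not at this
      obtain ⟨d, hd, hxy⟩ := this
      exact ⟨d, hd, fun z hz hzy => hxy (by rw [← (hzy : z = y)]; exact hz)⟩
  obtain ⟨e, he, hecd⟩ := U.exists_ball_subset_inter hc hd
  obtain ⟨y, hyx, hy⟩ := hU x e he
  exact hdA y ⟨(hecd x hy).1, hyx⟩ (hecd x hy).2 rfl

theorem definable_exists_ball {α : Type} {i : α} {P : (α → M) → M → Prop}
    (h : (univ : Set M).Definable L {w : α ⊕ Fin 1 → M | P (w ∘ Sum.inl) (w (Sum.inr 0))}) :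
    (univ : Set M).Definable L
      {v : α → M | ∃ c ∈ U.dom, ∀ z ∈ U.ball c (v i), P v z} := by
  have hdom : (univ : Set M).Definable L {w : α ⊕ Fin U.n → M | w ∘ Sum.inr ∈ U.dom} :=
    Definable.preimage_comp Sum.inr U.dom_def
  have hball : (univ : Set M).Definable L {w : (α ⊕ Fin U.n) ⊕ Fin 1 → M |
      w (Sum.inr 0) ∈ U.ball (w ∘ Sum.inl ∘ Sum.inr) (w (Sum.inl (Sum.inl i)))} := by
    convert Definable.preimage_comp (Sum.elim ![Sum.inl (Sum.inl i), Sum.inr 0]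
      (Sum.inl ∘ Sum.inr) : Fin 2 ⊕ Fin U.n → (α ⊕ Fin U.n) ⊕ Fin 1) U.phi_def using 1
    ext w
    simp only [mem_preimage, Sum.comp_elim, ball, ent, mem_ofPred_eq]
    congr! 2
    ext j
    fin_cases j <;> rfl
  have hP : (univ : Set M).Definable L {w : (α ⊕ Fin U.n) ⊕ Fin 1 → M |
      P (w ∘ Sum.inl ∘ Sum.inl) (w (Sum.inr 0))} :=
    h.preimage_comp (Sum.elim (Sum.inl ∘ Sum.inl) Sum.inr)
  convert (definable_and hdom (definable_forall (α := α ⊕ Fin U.n)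
    (P := fun v z => z ∈ U.ball (v ∘ Sum.inr) (v (Sum.inl i)) → P (v ∘ Sum.inl) z)
    (definable_imp hball hP))).exists_of_finite using 1
  ext v
  simp

end DefUniformBasis

/-- A definable relation with uniformly finite fibers, infinitely many of whose opposite fibers
have interior, yields a locally constant correspondence with infinite image. -/
theorem exists_locally_constant_of_infinite (U : DefUniformBasis L M) {G : Set (M × M)}
    (hG : DefRel1 L M G) {n : ℕ} (hn : ∀ x, {y | (x, y) ∈ G}.encard ≤ n)
    (hinf : {y | (U.interior1 {x | (x, y) ∈ G}).Nonempty}.Infinite) :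
    ∃ Uo : Set M, Uo.Nonempty ∧ DefSet1 L M Uo ∧ U.IsOpen1 Uo ∧
      ∃ G : Set (M × M), DefRel1 L M G ∧ (∀ p ∈ G, p.1 ∈ Uo) ∧
        (∀ x ∈ Uo, {y | (x, y) ∈ G}.Nonempty ∧ {y | (x, y) ∈ G}.Finite) ∧
        (∀ x ∈ Uo, ∃ c ∈ U.dom, ∀ x' ∈ Uo,
          x' ∈ U.ball c x → {y | (x', y) ∈ G} = {y | (x, y) ∈ G}) ∧
        {y | ∃ x, (x, y) ∈ G}.Infinite := by
  set H : Set (M × M) := {p | p.1 ∈ U.interior1 {x | (x, p.2) ∈ G}}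
  have hHG : H ⊆ G := fun p hp => U.interior1_subset _ hp
  have hfin : ∀ x, {y | (x, y) ∈ H}.Finite := fun x =>
    (finite_of_encard_le_coe (hn x)).subset fun y hy => hHG hy
  have hcard : ∀ x, {y | (x, y) ∈ H}.ncard ≤ n := fun x => by
    have h := (encard_le_encard (show {y | (x, y) ∈ H} ⊆ {y | (x, y) ∈ G} from fun y hy => hHG hy)).trans
      (hn x)
    rw [← (hfin x).cast_ncard_eq] at h
    exact_mod_cast h
  have hH : (univ : Set M).Definable₂ L H :=
    U.definable_exists_ball (α := Fin 2) (i := 0) (P := fun v z => (z, v 1) ∈ G)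
      (definable_pair hG (Sum.inr 0) (Sum.inl 1))
  set V : Set M := {x | (∃ y, (x, y) ∈ H) ∧ ∃ c ∈ U.dom, ∀ z ∈ U.ball c x,
    ∀ y, (z, y) ∈ H ↔ (x, y) ∈ H}
  have hV : (univ : Set M).Definable₁ L V := by
    refine definable_and (definable_exists (definable_pair hH (Sum.inl 0) (Sum.inr 0)))
      (U.definable_exists_ball (α := Fin 1) (i := 0)
        (P := fun v z => ∀ y, (z, y) ∈ H ↔ (v 0, y) ∈ H)
        (definable_forall (α := Fin 1 ⊕ Fin 1)
          (P := fun v y => (v (Sum.inr 0), y) ∈ H ↔ (v (Sum.inl 0), y) ∈ H) ?_))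
    have h1 := definable_pair hH (Sum.inl (Sum.inr 0) : (Fin 1 ⊕ Fin 1) ⊕ Fin 1) (Sum.inr 0)
    have h2 := definable_pair hH (Sum.inl (Sum.inl 0) : (Fin 1 ⊕ Fin 1) ⊕ Fin 1) (Sum.inr 0)
    convert definable_and (definable_imp h1 h2) (definable_imp h2 h1) using 1
    ext w
    exact iff_iff_implies_and_implies
  have hVo : U.IsOpen1 V := by
    rintro x ⟨⟨y, hy⟩, c, hc, hcx⟩
    obtain ⟨d, hd, hdc, hdd⟩ := U.exists_ball_ball_subset hc
    refine ⟨d, hd, fun z hz => ⟨⟨y, (hcx z (hdc x hz) y).2 hy⟩, d, hd, fun w hw y => ?_⟩⟩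
    rw [hcx w (hdd x z hz hw), hcx z (hdc x hz)]
  have himage : ∀ y, (U.interior1 {x | (x, y) ∈ G}).Nonempty → ∃ x ∈ V, (x, y) ∈ H := by
    intro y hy
    have hbdd : BddAbove ((fun x => {y | (x, y) ∈ H}.ncard) '' U.interior1 {x | (x, y) ∈ G}) :=
      ⟨n, by rintro _ ⟨x, -, rfl⟩; exact hcard x⟩
    obtain ⟨x, hx, hxmax⟩ := Nat.sSup_mem (hy.image _) hbdd
    refine ⟨x, ⟨⟨y, hx⟩, ?_⟩, hx⟩
    obtain ⟨c, hc, hcx⟩ := U.exists_ball_forall_of_finite (hfin x)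
      (A := fun y' => U.interior1 {x | (x, y') ∈ G}) (x := x)
      fun y' hy' => U.isOpen1_interior1 _ x hy'
    refine ⟨c, hc, fun z hz y' => ?_⟩
    have hle : {y | (z, y) ∈ H}.ncard ≤ {y | (x, y) ∈ H}.ncard :=
      (le_csSup hbdd ⟨z, hcx y hx hz, rfl⟩).trans_eq hxmax.symm
    have heq := eq_of_subset_of_ncard_le (fun y' hy' => hcx y' hy' hz) hle (hfin z)
    exact (Set.ext_iff.1 heq y').symm
  refine ⟨V, ?_, hV, hVo, {p | p.1 ∈ V ∧ p ∈ H}, ?_, fun p hp => hp.1, fun x hx => ⟨?_, ?_⟩, ?_, ?_⟩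
  · obtain ⟨y, hy⟩ := hinf.nonempty
    exact (himage y hy).imp fun x hx => hx.1
  · exact definable_and (definable_coord hV 0) hH
  · exact hx.1.imp fun y hy => ⟨hx, hy⟩
  · exact (hfin x).subset fun y hy => hy.2
  · intro x hx
    obtain ⟨c, hc, hcx⟩ := hx.2
    refine ⟨c, hc, fun z hz hzx => ?_⟩
    ext y
    simp only [mem_ofPred_eq, hz, hx, true_and, hcx z hzx y]
  · exact hinf.mono fun y hy => (himage y hy).imp fun x hx => hx

/-- Failure of exchange is witnessed by a definable relation with uniformly finite fibers,
infinitely many of whose opposite fibers are infinite. -/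
theorem exists_relation_of_not_exchange (hs : IsLPlusSaturated L M) {K : Set M} {a b : M}
    (hb : b ∈ aclOf L M (K ∪ {a})) (hbK : b ∉ aclOf L M K) (ha : a ∉ aclOf L M (K ∪ {b})) :
    ∃ (G : Set (M × M)) (n : ℕ), DefRel1 L M G ∧ (∀ x, {y | (x, y) ∈ G}.encard ≤ n) ∧
      {y | {x | (x, y) ∈ G}.Infinite}.Infinite := by
  obtain ⟨A, hA, hAf, hbA⟩ := mem_aclOf_iff.1 hb
  obtain ⟨H, hH, rfl⟩ := exists_definable_fiber_eq hA
  obtain ⟨C, hCK, hC⟩ := definable_iff_finitely_definable.1 hH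
  set n := {y | (a, y) ∈ H}.ncard
  have hbC : b ∉ aclOf L M (C : Set M) := fun h => hbK (aclOf_mono hCK h)
  have haC : a ∉ aclOf L M (C ∪ {b} : Set M) :=
    fun h => ha (aclOf_mono (union_subset_union_left _ hCK) h)
  set G : Set (M × M) := {p | p ∈ H ∧ p.1 ∉ {x | ((n + 1 : ℕ) : ℕ∞) ≤ {y | (x, y) ∈ H}.encard}}
  have hG : (C : Set M).Definable₂ L G :=
    definable_and hC (definable_coord (definable_le_encard_right hC (n + 1)) 0).compl
  have hab : (a, b) ∈ G := by
    refine ⟨hbA, ?_⟩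
    simp only [mem_ofPred_eq, not_le]
    rw [← hAf.cast_ncard_eq]
    exact_mod_cast Nat.lt_succ_self n
  refine ⟨G, n, hG.mono (subset_univ _), fun x => ?_, fun hfin => ?_⟩
  · by_cases hx : ∃ y, (x, y) ∈ G
    · obtain ⟨y, -, hy⟩ := hx
      simp only [mem_ofPred_eq, not_le] at hy
      refine (encard_le_encard fun y hy => hy.1).trans ?_
      push_cast at hy
      exact Order.le_of_lt_add_one hy
    · have : {y | (x, y) ∈ G} = ∅ := by
        ext y
        simpa using fun h => hx ⟨y, h⟩
      simp [this]
  · have hinf : {x | (x, b) ∈ G}.Infinite :=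
      infinite_of_notMem_aclOf (definable_fiber hG b) hab haC
    obtain ⟨y, hy, hyY⟩ := hs.exists_notMem_aclOf (C.finite_toSet.union hfin)
      (Y := fun N => {y | (N : ℕ∞) ≤ {x | (x, y) ∈ G}.encard})
      (fun N N' h y hy => (Nat.cast_le (α := ℕ∞).2 h).trans hy)
      (fun N => (definable_le_encard_left hG N).mono subset_union_left)
      (fun N => infinite_of_notMem_aclOf (definable_le_encard_left hG N)
        (by simp [hinf.encard_eq]) hbC)
    refine hy (subset_aclOf (Or.inr ?_))
    rw [mem_ofPred_eq, ← encard_eq_top_iff, ENat.eq_top_iff_forall_ge]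
    exact hyY

/-- A locally constant correspondence with infinite image contradicts exchange. -/
theorem exists_not_exchange (S : Setting L M) {V : Set M} (hV : S.toDefUniformBasis.IsOpen1 V)
    {G : Set (M × M)} (hG : DefRel1 L M G) (hGV : ∀ p ∈ G, p.1 ∈ V)
    (hfin : ∀ x ∈ V, {y | (x, y) ∈ G}.Finite)
    (hloc : ∀ x ∈ V, ∃ c ∈ S.toDefUniformBasis.dom, ∀ x' ∈ V,
      x' ∈ S.toDefUniformBasis.ball c x → {y | (x', y) ∈ G} = {y | (x, y) ∈ G})
    (hinf : {y | ∃ x, (x, y) ∈ G}.Infinite) :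
    ∃ (K : Set M) (a b : M), b ∈ aclOf L M (K ∪ {a}) ∧ b ∉ aclOf L M K ∧
      a ∉ aclOf L M (K ∪ {b}) := by
  obtain ⟨C, -, hC⟩ := definable_iff_finitely_definable.1 hG
  have hC : (C : Set M).Definable₂ L G := hC
  have himage : (C : Set M).Definable₁ L {y | ∃ x, (x, y) ∈ G} :=
    definable_exists (definable_pair hC (Sum.inr 0) (Sum.inl 0))
  obtain ⟨b, hb, hbG⟩ := S.saturated.exists_notMem_aclOf C.finite_toSet
    (fun _ _ _ => le_rfl) (fun _ : ℕ => himage) fun _ => hinf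
  obtain ⟨x, hx⟩ := hbG 0
  have hxV := hGV _ hx
  obtain ⟨c, hc, hcx⟩ := hloc x hxV
  obtain ⟨d, hd, hdV⟩ := hV x hxV
  obtain ⟨e, he, hecd⟩ := S.exists_ball_subset_inter hc hd
  have hfiber : {x | (x, b) ∈ G}.Infinite :=
    (S.ball_infinite S.noIsolated he x).mono fun z hz =>
      (Set.ext_iff.1 (hcx z (hdV (hecd x hz).2) (hecd x hz).1) b).2 hx
  obtain ⟨a, ha, haG⟩ := S.saturated.exists_notMem_aclOf (C.finite_toSet.union (finite_singleton b))
    (fun _ _ _ => le_rfl) (fun _ : ℕ => definable_fiber hC b) fun _ => hfiber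
  have hfst : (C ∪ {a} : Set M).Definable₁ L {y | (a, y) ∈ G} :=
    definable_fiber (G := Prod.swap ⁻¹' G)
      (definable_pair hC (1 : Fin 2) 0) a
  exact ⟨C, a, b, mem_aclOf_iff.2 ⟨_, hfst, hfin a (hGV _ (haG 0)), haG 0⟩, hb, ha⟩

/-- Exactly one of the following holds: (1) there is a nonempty definable open
`U ⊆ M` and a locally constant correspondence `U ⇉ M` with infinite image; (2) algebraic
closure satisfies exchange on `M`. -/
theorem statement9 (S : Setting L M) :
    Xor'
      (∃ Uo : Set M, Uo.Nonempty ∧ DefSet1 L M Uo ∧ S.toDefUniformBasis.IsOpen1 Uo ∧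
        ∃ G : Set (M × M), DefRel1 L M G ∧ (∀ p ∈ G, p.1 ∈ Uo) ∧
          (∀ x ∈ Uo, {y | (x, y) ∈ G}.Nonempty ∧ {y | (x, y) ∈ G}.Finite) ∧
          (∀ x ∈ Uo, ∃ c ∈ S.toDefUniformBasis.dom, ∀ x' ∈ Uo,
            x' ∈ S.toDefUniformBasis.ball c x → {y | (x', y) ∈ G} = {y | (x, y) ∈ G}) ∧
          {y | ∃ x, (x, y) ∈ G}.Infinite)
      (∀ (K : Set M) (a b : M), b ∈ aclOf L M (K ∪ {a}) → b ∉ aclOf L M K →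
        a ∈ aclOf L M (K ∪ {b})) := by
  by_cases hex : ∀ (K : Set M) (a b : M), b ∈ aclOf L M (K ∪ {a}) → b ∉ aclOf L M K →
      a ∈ aclOf L M (K ∪ {b})
  · refine Or.inr ⟨hex, ?_⟩
    rintro ⟨V, -, -, hV, G, hG, hGV, hfin, hloc, hinf⟩
    obtain ⟨K, a, b, hb, hbK, ha⟩ :=
      exists_not_exchange S hV hG hGV (fun x hx => (hfin x hx).2) hloc hinf
    exact ha (hex K a b hb hbK)
  · refine Or.inl ⟨?_, hex⟩
    push Not at hex
    obtain ⟨K, a, b, hb, hbK, ha⟩ := hex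
    obtain ⟨G, n, hG, hn, hinf⟩ := exists_relation_of_not_exchange S.saturated hb hbK ha
    refine exists_locally_constant_of_infinite S.toDefUniformBasis hG hn (hinf.mono fun y hy => ?_)
    exact S.infInterior _ ((definable_fiber hG y).mono (subset_univ _)) hy

end DpTame
end
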